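/- arXiv:2010.08894 — 4 statements merged into one kernel-verified Lean document; each statement's English description precedes it below -/
import Mathlib

section
/- Let n be an odd prime, q ∈ ℂ a primitive n-th root of unity, and a, b ∈ ℂ nonzero with β ∈ ℂ an n-th root of b (βⁿ = b). Let L_a be the n×n matrix with (L_a)_{0,n−1} = a, (L_a)_{i,i−1} = 1 for 1 ≤ i ≤ n−1, and all other entries 0, and let M_b be the diagonal n×n matrix with (M_b)_{i,i} = β·q^{−2i} for i = 0,…,n−1. Then the ℂ-subalgebra of Mₙ(ℂ) generated by L_a and M_b is all of Mₙ(ℂ). -/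
/-- If the diagonal entries are distinct, the diagonal matrix units are polynomials in the
diagonal matrix. -/
theorem Matrix.single_self_mem_adjoin_diagonal {ι K : Type*} [Fintype ι] [DecidableEq ι] [Field K]
    {d : ι → K} (hd : Function.Injective d) (i : ι) :
    Matrix.single i i (1 : K) ∈ Algebra.adjoin K {Matrix.diagonal d} := by
  have h : Polynomial.aeval (Matrix.diagonal d) (Lagrange.basis Finset.univ d i)
      = Matrix.single i i (1 : K) := by
    have h1 : Matrix.diagonal d = Matrix.diagonalAlgHom K d := rfl
    rw [h1, Polynomial.aeval_algHom_apply, ← Matrix.diagonal_single,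
      Matrix.diagonalAlgHom_apply]
    congr 1
    ext j
    rw [Polynomial.aeval_pi_apply]
    beta_reduce
    rw [Polynomial.coe_aeval_eq_eval]
    rcases eq_or_ne j i with rfl | hji
    · simp [Lagrange.eval_basis_self hd.injOn (Finset.mem_univ j)]
    · simp [Lagrange.eval_basis_of_ne hji.symm (Finset.mem_univ j), hji]
  exact h ▸ Polynomial.aeval_mem_adjoin_singleton K _

/-- A subalgebra of matrices containing all matrix units is everything. -/
theorem Matrix.subalgebra_eq_top_of_single_mem {ι K : Type*} [Fintype ι] [DecidableEq ι]
    [CommSemiring K] (S : Subalgebra K (Matrix ι ι K))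
    (h : ∀ i j, Matrix.single i j (1 : K) ∈ S) : S = ⊤ := by
  refine eq_top_iff.2 fun A _ => ?_
  rw [Matrix.matrix_eq_sum_single A]
  refine sum_mem fun i _ => sum_mem fun j _ => ?_
  simpa [Matrix.smul_single] using S.smul_mem (h i j) (A i j)

/-- The powers `q ^ (-2 i)`, `0 ≤ i < n`, of a primitive `n`-th root of unity are distinct when
`n` is odd. -/
theorem IsPrimitiveRoot.injective_zpow_neg_two_mul_val {K : Type*} [Field K] {n : ℕ} [NeZero n]
    (hodd : Odd n) {q : K} (hq : IsPrimitiveRoot q n) :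
    Function.Injective fun i : ZMod n => q ^ (-(2 * (i.val : ℤ))) := by
  intro i j h
  have hq0 : q ≠ 0 := hq.ne_zero (NeZero.ne n)
  have h1 : q ^ (2 * (i.val : ℤ) - 2 * (j.val : ℤ)) = 1 := by
    have h' : q ^ (-(2 * (i.val : ℤ))) = q ^ (-(2 * (j.val : ℤ))) := h
    rw [zpow_neg, zpow_neg, inv_inj] at h'
    rw [zpow_sub₀ hq0, h', div_self (zpow_ne_zero _ hq0)]
  rw [hq.zpow_eq_one_iff_dvd, ← mul_sub] at h1
  have h2 : (n : ℤ) ∣ (i.val : ℤ) - j.val :=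
    Int.dvd_of_dvd_mul_right_of_gcd_one h1
      ((Int.gcd_natCast_natCast n 2).trans hodd.coprime_two_right)
  have h3 := (ZMod.intCast_zmod_eq_zero_iff_dvd _ n).2 h2
  simpa [sub_eq_zero] using h3

/-- The representation `ρ_{a,b}` of the noncommutative torus, sending `l ↦ L_a` and
`m ↦ M_b`, is irreducible: `L_a` and `M_b` generate all of `Mₙ(ℂ)` as a ℂ-algebra. -/
theorem adjoin_La_Mb_eq_top
    (n : ℕ) [NeZero n] (hp : Nat.Prime n) (hodd : Odd n)
    (q : ℂ) (hq : IsPrimitiveRoot q n)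
    (a b β : ℂ) (ha : a ≠ 0) (hb : b ≠ 0) (hβ : β ^ n = b)
    (L M : Matrix (ZMod n) (ZMod n) ℂ)
    (hL : ∀ i j : ZMod n, L i j = if i = j + 1 then (if i = 0 then a else 1) else 0)
    (hM : ∀ i j : ZMod n, M i j = if i = j then β * q ^ (-(2 * (i.val : ℤ))) else 0) :
    Algebra.adjoin ℂ ({L, M} : Set (Matrix (ZMod n) (ZMod n) ℂ)) = ⊤ := by
  have hβ0 : β ≠ 0 := by
    rintro rfl
    exact hb (by rw [← hβ, zero_pow (NeZero.ne n)])
  have hMd : M = Matrix.diagonal fun i : ZMod n => β * q ^ (-(2 * (i.val : ℤ))) := by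
    ext i j
    rw [hM, Matrix.diagonal_apply]
  set S := Algebra.adjoin ℂ ({L, M} : Set (Matrix (ZMod n) (ZMod n) ℂ))
  have hdiag (i : ZMod n) : Matrix.single i i (1 : ℂ) ∈ S := by
    have hinj : Function.Injective fun i : ZMod n => β * q ^ (-(2 * (i.val : ℤ))) :=
      (mul_right_injective₀ hβ0).comp (hq.injective_zpow_neg_two_mul_val hodd)
    have h := Matrix.single_self_mem_adjoin_diagonal hinj i
    rw [← hMd] at h
    exact Algebra.adjoin_mono (by simp) h
  have hstep (j : ZMod n) : Matrix.single (j + 1) j (1 : ℂ) ∈ S := by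
    have hc : (if j + 1 = 0 then a else 1) ≠ 0 := by split_ifs <;> simp [ha]
    have h : Matrix.single (j + 1) j (1 : ℂ) =
        (if j + 1 = 0 then a else 1)⁻¹ • (L * Matrix.single j j (1 : ℂ)) := by
      ext i k
      rw [Matrix.smul_apply]
      rcases eq_or_ne k j with rfl | hk
      · rw [Matrix.mul_single_apply_same, hL]
        rcases eq_or_ne i (k + 1) with rfl | hi
        · simp [hc]
        · simp [hi, hi.symm]
      · rw [Matrix.mul_single_apply_of_ne _ _ _ _ _ hk]
        simp [hk.symm]
    rw [h]
    exact S.smul_mem (S.mul_mem (Algebra.subset_adjoin (by simp)) (hdiag j)) _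
  have hadd (j : ZMod n) (k : ℕ) : Matrix.single (j + k) j (1 : ℂ) ∈ S := by
    induction k with
    | zero => simpa using hdiag j
    | succ k ih => simpa [add_assoc] using S.mul_mem (hstep (j + k)) ih
  refine Matrix.subalgebra_eq_top_of_single_mem S fun i j => ?_
  simpa using hadd j (i - j).val
end

section
/- Let n be an odd prime and q ∈ ℂ a primitive n-th root of unity. Let L be the n×n complex matrix with L_{i,j} = 1 if i ≡ j+1 (mod n) and 0 otherwise, and M the n×n diagonal complex matrix with M_{i,i} = q^{−2i} for i = 0,…,n−1. Let a, b, c, d ∈ ℤ with ad − bc = 1 and n ∤ b, and let b′ ∈ ℤ satisfy b·b′ ≡ 1 (mod n). Let C be the n×n complex matrix with entries C_{i,j} = q^{−b′d(i−aj)² − 2cj(i−aj) − acj²} for i, j ∈ {0,…,n−1} (exponents are integers, well defined since qⁿ = 1). Then for all integers p, t: C · (q^{−pt}·Lᵖ·Mᵗ) = (q^{−(ap+bt)(cp+dt)}·L^{ap+bt}·M^{cp+dt}) · C. -/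
/-- A one-parameter family of matrices indexed by `ℤ` consists of the powers of its value at `1`. -/
theorem Matrix.zpow_eq_of_map_add {ι R : Type*} [Fintype ι] [DecidableEq ι] [CommRing R]
    (f : ℤ → Matrix ι ι R) (h0 : f 0 = 1) (hadd : ∀ x y, f (x + y) = f x * f y) (k : ℤ) :
    f 1 ^ k = f k := by
  have hu : IsUnit (f 1).det := by
    refine (Matrix.isUnit_iff_isUnit_det _).1 (IsUnit.of_mul_eq_one (f (-1)) ?_)
    rw [← hadd, add_neg_cancel, h0]
  induction k using Int.induction_on with
  | zero => rw [zpow_zero, h0]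
  | succ k ih => rw [Matrix.zpow_add_one hu, ih, ← hadd]
  | pred k ih =>
    rw [Matrix.zpow_sub_one hu, ih]
    rw [← sub_add_cancel (-(k : ℤ)) 1, hadd, Matrix.mul_assoc, Matrix.mul_nonsing_inv _ hu,
      Matrix.mul_one, sub_add_cancel]

/-- Powers of a root of unity of order `n` depend only on the exponent modulo `n`. -/
theorem IsPrimitiveRoot.zpow_eq_zpow_of_intCast_eq {K : Type*} [Field K] {q : K} {n : ℕ} [NeZero n]
    (hq : IsPrimitiveRoot q n) {k m : ℤ} (h : (k : ZMod n) = m) : q ^ k = q ^ m := by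
  have hq0 : q ≠ 0 := hq.ne_zero (NeZero.ne n)
  have hdvd : (n : ℤ) ∣ k - m := by
    rw [← ZMod.intCast_zmod_eq_zero_iff_dvd, Int.cast_sub, h, sub_self]
  rw [← sub_add_cancel k m, zpow_add₀ hq0, (hq.zpow_eq_one_iff_dvd _).2 hdvd, one_mul]

/-- Integer powers of the cyclic shift matrix. -/
theorem Matrix.zpow_cyclicShift {n : ℕ} [NeZero n] {R : Type*} [CommRing R]
    {L : Matrix (ZMod n) (ZMod n) R} (hL : ∀ i j, L i j = if i = j + 1 then 1 else 0) (k : ℤ) :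
    L ^ k = Matrix.of fun i j : ZMod n => if i = j + (k : ZMod n) then (1 : R) else 0 := by
  have key := Matrix.zpow_eq_of_map_add
    (fun k : ℤ => Matrix.of fun i j : ZMod n => if i = j + (k : ZMod n) then (1 : R) else 0)
    (by ext i j; simp [Matrix.one_apply])
    (by
      intro x y
      ext i j
      simp only [Matrix.mul_apply, Matrix.of_apply, mul_ite, mul_one, mul_zero]
      simp [add_comm, add_left_comm]) k
  rw [← key]
  congr 1
  ext i j
  simp [hL]

/-- Integer powers of the diagonal clock matrix with entries `q ^ (-2 i)`. -/
theorem Matrix.zpow_clock {n : ℕ} [NeZero n] {K : Type*} [Field K] {q : K} (hq0 : q ≠ 0)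
    {M : Matrix (ZMod n) (ZMod n) K}
    (hM : ∀ i j, M i j = if i = j then q ^ (-(2 * (i.val : ℤ))) else 0) (k : ℤ) :
    M ^ k = Matrix.diagonal fun i : ZMod n => q ^ (-(2 * (i.val : ℤ)) * k) := by
  have key := Matrix.zpow_eq_of_map_add
    (fun k : ℤ => Matrix.diagonal fun i : ZMod n => q ^ (-(2 * (i.val : ℤ)) * k))
    (by simp)
    (by
      intro x y
      simp only [Matrix.diagonal_mul_diagonal, ← zpow_add₀ hq0, mul_add]) k
  rw [← key]
  congr 1
  ext i j
  simp [hM, Matrix.diagonal_apply]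

/-- The matrix `C` with entries `C_{i,j} = q^{-b'd(i-aj)² - 2cj(i-aj) - acj²}` conjugates the
representation `ρ(e_{p,t}) = q^{-pt} Lᵖ Mᵗ` into `ρ(e_{ap+bt, cp+dt})`, realizing the action
of `B = [[a,b],[c,d]] ∈ SL₂(ℤ)`. -/
theorem conjugating_matrix_intertwines
    (n : ℕ) [NeZero n] (hp : Nat.Prime n) (hodd : Odd n)
    (q : ℂ) (hq : IsPrimitiveRoot q n)
    (L M : Matrix (ZMod n) (ZMod n) ℂ)
    (hL : ∀ i j : ZMod n, L i j = if i = j + 1 then 1 else 0)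
    (hM : ∀ i j : ZMod n, M i j = if i = j then q ^ (-(2 * (i.val : ℤ))) else 0)
    (a b c d : ℤ) (hdet : a * d - b * c = 1) (hnb : ¬ (n : ℤ) ∣ b)
    (b' : ℤ) (hb' : b * b' ≡ 1 [ZMOD n])
    (C : Matrix (ZMod n) (ZMod n) ℂ)
    (hC : ∀ i j : ZMod n, C i j
      = q ^ (-(b' * d) * ((i.val : ℤ) - a * (j.val : ℤ)) ^ 2
          - 2 * c * (j.val : ℤ) * ((i.val : ℤ) - a * (j.val : ℤ))
          - a * c * (j.val : ℤ) ^ 2)) :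
    ∀ p t : ℤ,
      C * (q ^ (-(p * t)) • (L ^ p * M ^ t))
        = (q ^ (-((a * p + b * t) * (c * p + d * t)))
            • (L ^ (a * p + b * t) * M ^ (c * p + d * t))) * C := by
  intro p t
  have hq0 : q ≠ 0 := hq.ne_zero (NeZero.ne n)
  have hbb : (b : ZMod n) * (b' : ZMod n) = 1 := by
    have h := (ZMod.intCast_eq_intCast_iff _ _ n).2 hb'
    push_cast at h
    exact h
  have hdet' : (a : ZMod n) * d - b * c = 1 := by
    exact_mod_cast congrArg (Int.cast : ℤ → ZMod n) hdet
  rw [Matrix.zpow_cyclicShift hL, Matrix.zpow_cyclicShift hL, Matrix.zpow_clock hq0 hM,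
    Matrix.zpow_clock hq0 hM, Matrix.mul_smul, Matrix.smul_mul, ← Matrix.mul_assoc,
    Matrix.mul_assoc (Matrix.of _)]
  ext i j
  have hshift : ∀ k x : ZMod n, i = x + k ↔ x = i - k := fun k x =>
    ⟨fun h => by rw [h, add_sub_cancel_right], fun h => by rw [h, sub_add_cancel]⟩
  simp only [Matrix.smul_apply, Matrix.diagonal_apply, Matrix.mul_apply,
    Matrix.of_apply, mul_ite, ite_mul, mul_one, one_mul, mul_zero, zero_mul, hshift,
    Finset.sum_ite_eq, Finset.sum_ite_eq', Finset.mem_univ, if_true, hC, smul_eq_mul,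
    ← zpow_add₀ hq0]
  apply hq.zpow_eq_zpow_of_intCast_eq
  push_cast
  simp only [ZMod.natCast_val, ZMod.cast_id', id_eq]
  linear_combination (-2 * (d : ZMod n) * (i - a * j - a * p) * t + b * d * t ^ 2) * hbb
    + (2 * j * t + p * t) * hdet'
end

section
/- Let n be an odd prime and q = e^{2πi/n} ∈ ℂ. Let a, b, c, d ∈ ℤ with ad − bc = 1 and n ∤ b, let b′ ∈ ℤ satisfy b·b′ ≡ 1 (mod n), and let C be the n×n complex matrix with entries C_{i,j} = q^{−b′d(i−aj)² − 2cj(i−aj) − acj²} for i, j ∈ {0,…,n−1}. Set K_B := −(b′d(1−a)² + c(2−a)) ∈ ℤ and assume n ∤ K_B. Then Tr(C) = (K_B/n) · ((1 + i^{−n})/(1 + i^{−1})) · √n, where (K_B/n) is the Legendre symbol of K_B modulo n and i = √−1. -/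
section

open Complex Filter Topology

theorem summable_exp_neg_pi_mul_int_sq {x : ℝ} (hx : 0 < x) :
    Summable fun k : ℤ ↦ Real.exp (-Real.pi * x * (k : ℝ) ^ 2) := by
  have h := ((summable_jacobiTheta₂_term_iff 0 (x * I)).2 (by simpa using hx)).norm
  refine h.congr fun k ↦ ?_
  rw [norm_jacobiTheta₂_term]
  congr 1
  simp
  ring

theorem norm_exp_neg_pi_mul_int_sq (z : ℂ) (k : ℤ) :
    ‖cexp (-Real.pi * z * (k : ℂ) ^ 2)‖ = Real.exp (-Real.pi * z.re * (k : ℝ) ^ 2) := by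
  rw [norm_exp]
  congr 1
  rw [show -(Real.pi : ℂ) * z * (k : ℂ) ^ 2 = ((-Real.pi * (k : ℝ) ^ 2 : ℝ) : ℂ) * z by
    push_cast; ring, re_ofReal_mul]
  ring

theorem tendsto_tsum_exp_neg_pi_mul_int_sq {α : Type*} {l : Filter α} {a : α → ℂ}
    (ha : Tendsto (fun x ↦ (a x).re) l atTop) (θ : ℝ) :
    Tendsto (fun x ↦ ∑' k : ℤ,
      cexp (-Real.pi * a x * (k : ℂ) ^ 2 + 2 * Real.pi * (θ * I) * k)) l (𝓝 1) := by
  have hn (x : α) (k : ℤ) :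
      ‖cexp (-Real.pi * a x * (k : ℂ) ^ 2 + 2 * Real.pi * (θ * I) * k)‖ =
        Real.exp (-Real.pi * (a x).re * (k : ℝ) ^ 2) := by
    rw [exp_add, norm_mul, norm_exp_neg_pi_mul_int_sq,
      show 2 * (Real.pi : ℂ) * (θ * I) * k = ((2 * Real.pi * θ * k : ℝ) : ℂ) * I by
        push_cast; ring, norm_exp_ofReal_mul_I, mul_one]
  rw [← tsum_ite_eq (0 : ℤ) (fun _ ↦ (1 : ℂ))]
  refine tendsto_tsum_of_dominated_convergence (summable_exp_neg_pi_mul_int_sq one_pos)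
    (fun k ↦ ?_) ?_
  · rcases eq_or_ne k 0 with rfl | hk
    · simpa using tendsto_const_nhds
    · rw [if_neg hk, tendsto_zero_iff_norm_tendsto_zero]
      simp_rw [hn]
      refine Real.tendsto_exp_atBot.comp ?_
      have hk2 : 0 < (k : ℝ) ^ 2 := by positivity
      exact (ha.const_mul_atTop_of_neg (neg_lt_zero.2 Real.pi_pos)).atBot_mul_const hk2
  · filter_upwards [ha.eventually_ge_atTop 1] with x hx k
    rw [hn, Real.exp_le_exp]
    have : 0 ≤ Real.pi * (k : ℝ) ^ 2 := by positivity
    nlinarith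

theorem tsum_int_eq_sum_fin_tsum {m : ℕ} [NeZero m] {F : ℤ → ℂ} (hF : Summable F) :
    ∑' k, F k = ∑ r : Fin m, ∑' j : ℤ, F (j * m + (r : ℕ)) := by
  let e : Fin m × ℤ ≃ ℤ := (Equiv.prodComm _ _).trans (Int.divModEquiv m).symm
  have h : Summable fun p ↦ F (e p) := e.summable_iff.2 hF
  rw [← e.tsum_eq F, h.tsum_prod' fun r ↦ h.prod_factor r, tsum_fintype]
  rfl

theorem div_sq_cpow_half {z : ℂ} (hz : z ≠ 0) {x : ℝ} (hx : 0 < x) :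
    (z / (x : ℂ) ^ 2) ^ (1 / 2 : ℂ) = z ^ (1 / 2 : ℂ) / x := by
  have h2 : (x : ℂ) ^ 2 ≠ 0 := by simp [hx.ne']
  have hl : log (z / (x : ℂ) ^ 2) = log z - 2 * Real.log x := by
    rw [show z / (x : ℂ) ^ 2 = ((x ^ 2)⁻¹ : ℝ) * z by push_cast; field_simp,
      log_ofReal_mul (by positivity) hz]
    rw [Real.log_inv, Real.log_pow]
    push_cast
    ring
  rw [cpow_def_of_ne_zero (div_ne_zero hz h2), cpow_def_of_ne_zero hz, hl,
    show (log z - 2 * Real.log x) * (1 / 2) = log z * (1 / 2) - (Real.log x : ℂ) by ring,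
    exp_sub, ← ofReal_exp, Real.exp_log hx]

/-- The leading behaviour of a theta series with periodic coefficients, as `Re w → ∞`. -/
theorem tendsto_tsum_periodic_mul_exp {α : Type*} {l : Filter α} {w : α → ℂ}
    (hw : Tendsto (fun x ↦ (w x).re) l atTop) (m : ℕ) [NeZero m] {f : ℤ → ℂ}
    (hf : Function.Periodic f (m : ℤ)) :
    Tendsto (fun x ↦ (1 / w x ^ (1 / 2 : ℂ)) *
      ∑' k : ℤ, f k * cexp (-Real.pi / w x * (k : ℂ) ^ 2)) l
      (𝓝 ((1 / m : ℂ) * ∑ r : Fin m, f (r : ℕ))) := by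
  have hm : (m : ℂ) ≠ 0 := NeZero.ne _
  have hm' : (0 : ℝ) < m := Nat.cast_pos.2 (NeZero.pos m)
  have hwm : Tendsto (fun x ↦ (w x / (m : ℂ) ^ 2).re) l atTop := by
    refine (hw.atTop_div_const (pow_pos hm' 2)).congr fun x ↦ ?_
    rw [← ofReal_natCast, ← ofReal_pow, div_ofReal_re]
  have hfm (j : ℤ) (r : Fin m) : f (j * m + (r : ℕ)) = f (r : ℕ) := by
    simpa [add_comm] using hf.int_mul j (r : ℕ)
  have key : ∀ᶠ x in l, (1 / m : ℂ) * ∑ r : Fin m, f (r : ℕ) *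
      (∑' k : ℤ, cexp (-Real.pi * (w x / (m : ℂ) ^ 2) * (k : ℂ) ^ 2 +
        2 * Real.pi * (((-((r : ℕ) / m : ℝ) : ℝ) : ℂ) * I) * k)) = (1 / w x ^ (1 / 2 : ℂ)) *
      ∑' k : ℤ, f k * cexp (-Real.pi / w x * (k : ℂ) ^ 2) := by
    filter_upwards [hw.eventually_gt_atTop 0, hwm.eventually_gt_atTop 0] with x hx hxm
    have hx0 : w x ≠ 0 := by rintro h; simp [h] at hx
    have hsum : Summable fun k : ℤ ↦ f k * cexp (-Real.pi / w x * (k : ℂ) ^ 2) := by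
      obtain ⟨B, hB⟩ := (Set.finite_range fun r : Fin m ↦ ‖f (r : ℕ)‖).bddAbove
      have hi : 0 < (w x)⁻¹.re := by
        rw [inv_re]
        exact div_pos hx (normSq_pos.2 hx0)
      refine ((summable_exp_neg_pi_mul_int_sq hi).mul_left B).of_norm_bounded fun k ↦ ?_
      rw [norm_mul, div_eq_mul_inv, norm_exp_neg_pi_mul_int_sq]
      refine mul_le_mul_of_nonneg_right ?_ (Real.exp_nonneg _)
      rw [← (Int.divModEquiv m).symm_apply_apply k, Int.divModEquiv_symm_apply, hfm]
      exact hB ⟨_, rfl⟩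
    rw [tsum_int_eq_sum_fin_tsum (m := m) hsum, Finset.mul_sum, Finset.mul_sum]
    refine Finset.sum_congr rfl fun r _ ↦ ?_
    have hr : ∑' j : ℤ, f (j * m + (r : ℕ)) *
        cexp (-Real.pi / w x * ((j * m + (r : ℕ) : ℤ) : ℂ) ^ 2) =
        f (r : ℕ) * ∑' j : ℤ, cexp (-Real.pi / (w x / (m : ℂ) ^ 2) *
          (j + I * (((-((r : ℕ) / m : ℝ) : ℝ) : ℂ) * I)) ^ 2) := by
      rw [← tsum_mul_left]
      refine tsum_congr fun j ↦ ?_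
      rw [hfm, show I * (((-((r : ℕ) / m : ℝ) : ℝ) : ℂ) * I) = (r : ℕ) / m by
        push_cast; linear_combination (-((r : ℕ) / m : ℂ)) * I_mul_I]
      congr 2
      push_cast
      field_simp
    have hc : w x ^ (1 / 2 : ℂ) ≠ 0 := by simp [cpow_eq_zero_iff, hx0]
    have hd := div_sq_cpow_half hx0 hm'
    rw [ofReal_natCast] at hd
    rw [hr, tsum_exp_neg_quadratic hxm, hd]
    field_simp
  refine Tendsto.congr' key ?_
  refine Tendsto.const_mul _ (tendsto_finsetSum _ fun r _ ↦ ?_)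
  simpa using (tendsto_tsum_exp_neg_pi_mul_int_sq hwm (-((r : ℕ) / m : ℝ))).const_mul (f (r : ℕ))

/-- Gauss's evaluation of the quadratic Gauss sum, for an arbitrary positive modulus. -/
theorem sum_exp_two_pi_mul_I_sq_div (n : ℕ) [NeZero n] :
    ∑ r : Fin n, cexp (2 * Real.pi * I * ((r : ℕ) : ℂ) ^ 2 / n) =
      (1 + I ^ (-(n : ℤ))) / (1 + I⁻¹) * Real.sqrt n := by
  have hn : (n : ℂ) ≠ 0 := NeZero.ne _
  have hn' : (0 : ℝ) < n := Nat.cast_pos.2 (NeZero.pos n)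
  let w : ℝ → ℂ := fun u ↦ (n : ℂ) ^ 2 / 4 * (u : ℂ) ^ 2 - I * n / 2
  let v : ℝ → ℂ := fun u ↦ (((u ^ 2)⁻¹ : ℝ) : ℂ)
  let a : ℝ → ℂ := fun u ↦ 2 / (2 * v u + I * n)
  let f : ℤ → ℂ := fun k ↦ cexp (2 * Real.pi * I * (k : ℂ) ^ 2 / n)
  let g : ℤ → ℂ := fun k ↦ cexp (-(Real.pi * I * n * (k : ℂ) ^ 2 / 2))
  have hf : Function.Periodic f (n : ℤ) := fun k ↦ by
    refine exp_eq_exp_iff_exists_int.2 ⟨2 * k + n, ?_⟩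
    push_cast
    field_simp
    ring
  have hg : Function.Periodic g ((2 : ℕ) : ℤ) := fun k ↦ by
    refine exp_eq_exp_iff_exists_int.2 ⟨-(n * (k + 1)), ?_⟩
    push_cast
    ring
  have hsq : Tendsto (fun u : ℝ ↦ u ^ 2) atTop atTop := tendsto_pow_atTop two_ne_zero
  have hwre (u : ℝ) : (w u).re = (n : ℝ) ^ 2 / 4 * u ^ 2 := by
    have : w u = (((n : ℝ) ^ 2 / 4 * u ^ 2 : ℝ) : ℂ) + ((-(n / 2) : ℝ) : ℂ) * I := by
      simp only [w]; push_cast; ring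
    rw [this, add_re, ofReal_re, re_ofReal_mul, I_re, mul_zero, add_zero]
  have hw : Tendsto (fun u ↦ (w u).re) atTop atTop := by
    simp_rw [hwre]
    exact hsq.const_mul_atTop (by positivity)
  have hu : Tendsto (fun u : ℝ ↦ ((u : ℂ) ^ 2).re) atTop atTop := by
    simpa only [← ofReal_pow, ofReal_re] using hsq
  have hL := tendsto_tsum_periodic_mul_exp hw n hf
  have hR := tendsto_tsum_periodic_mul_exp hu 2 hg
  have hv : Tendsto v atTop (𝓝 0) := by
    rw [← ofReal_zero]
    exact (continuous_ofReal.tendsto 0).comp hsq.inv_tendsto_atTop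
  have hIn : I * (n : ℂ) ≠ 0 := mul_ne_zero I_ne_zero hn
  have ha : Tendsto a atTop (𝓝 (2 / (I * n))) := by
    have h := (hv.const_mul 2).add_const (I * (n : ℂ))
    rw [mul_zero, zero_add] at h
    exact tendsto_const_nhds.div h hIn
  have hwu : Tendsto (fun u ↦ (n : ℂ) ^ 2 / 4 - I * n / 2 * v u) atTop (𝓝 ((n : ℂ) ^ 2 / 4)) := by
    simpa using (hv.const_mul (I * (n : ℂ) / 2)).const_sub ((n : ℂ) ^ 2 / 4)
  have hs0 : (Real.sqrt n : ℂ) ≠ 0 := ofReal_ne_zero.2 (Real.sqrt_ne_zero'.2 hn')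
  have hss : (Real.sqrt n : ℂ) ^ 2 = n := by
    rw [← ofReal_pow, Real.sq_sqrt hn'.le, ofReal_natCast]
  have hI0 : (1 - I) ≠ 0 := fun h ↦ by simpa using congrArg re h
  have hsqrt : ((n : ℂ) ^ 2 / 4) ^ (1 / 2 : ℂ) = n / 2 := by
    rw [show (n : ℂ) ^ 2 / 4 = (((n / 2 : ℝ) : ℂ)) ^ 2 by push_cast; ring, one_div,
      sq_cpow_two_inv (by rw [ofReal_re]; positivity)]
    push_cast
    rfl
  have hsqrt' : (2 / (I * n) : ℂ) ^ (1 / 2 : ℂ) = (1 - I) / Real.sqrt n := by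
    rw [show 2 / (I * n) = ((1 - I) / Real.sqrt n) ^ 2 by
      rw [div_pow, hss]
      field_simp
      linear_combination (2 - I) * I_sq, one_div,
      sq_cpow_two_inv (by rw [div_ofReal_re]; simpa using hn')]
  have hslit : (n : ℂ) ^ 2 / 4 ∈ slitPlane := by
    rw [show (n : ℂ) ^ 2 / 4 = ((n ^ 2 / 4 : ℝ) : ℂ) by push_cast; rfl, ofReal_mem_slitPlane]
    positivity
  have hslit' : 2 / (I * n) ∈ slitPlane := by
    refine mem_slitPlane_iff.2 (.inr ?_)
    rw [show 2 / (I * n) = ((-(2 / n) : ℝ) : ℂ) * I by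
      push_cast; field_simp; rw [I_sq, neg_neg], im_ofReal_mul]
    simpa using hn'.ne'
  have hR' := (((hwu.cpow (tendsto_const_nhds (x := (1 / 2 : ℂ))) hslit).mul
    (ha.cpow (tendsto_const_nhds (x := (1 / 2 : ℂ))) hslit')).inv₀
    (by rw [hsqrt, hsqrt']; exact mul_ne_zero (by simpa using hn) (div_ne_zero hI0 hs0))).mul hR
  have key : (fun u ↦ (1 / w u ^ (1 / 2 : ℂ)) *
      ∑' k : ℤ, f k * cexp (-Real.pi / w u * (k : ℂ) ^ 2)) =ᶠ[atTop] fun u ↦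
      (((n : ℂ) ^ 2 / 4 - I * n / 2 * v u) ^ (1 / 2 : ℂ) * a u ^ (1 / 2 : ℂ))⁻¹ *
        ((1 / ((u : ℂ) ^ 2) ^ (1 / 2 : ℂ)) *
          ∑' k : ℤ, g k * cexp (-Real.pi / (u : ℂ) ^ 2 * (k : ℂ) ^ 2)) := by
    filter_upwards [eventually_gt_atTop 0] with u hu
    have hu0 : (u : ℂ) ≠ 0 := ofReal_ne_zero.2 hu.ne'
    have hw0 : w u ≠ 0 := fun h ↦ by
      have := hwre u
      rw [h, zero_re] at this
      exact absurd this (by positivity)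
    have hw2 : (n : ℂ) ^ 2 / 4 - I * n / 2 * v u = w u / (u : ℂ) ^ 2 := by
      simp only [w, v]
      push_cast
      field_simp
    have hd0 : 2 * v u + I * n ≠ 0 := fun h ↦ by
      rw [show 2 * v u = ((2 * (u ^ 2)⁻¹ : ℝ) : ℂ) by simp only [v]; push_cast; rfl,
        ← ofReal_natCast] at h
      have h2 := congrArg im h
      rw [add_im, ofReal_im, im_mul_ofReal, I_im, zero_im] at h2
      linarith
    have hainv : (a u)⁻¹ = ((u ^ 2)⁻¹ : ℝ) + ((n / 2 : ℝ) : ℂ) * I := by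
      simp only [a, v]
      push_cast
      field_simp
    have hare : 0 < (a u).re := by
      have h1 : 0 < ((a u)⁻¹).re := by
        rw [hainv, add_re, ofReal_re, re_ofReal_mul, I_re, mul_zero, add_zero]
        positivity
      rw [← inv_inv (a u), inv_re]
      refine div_pos h1 (normSq_pos.2 fun h ↦ ?_)
      rw [h] at h1
      simp at h1
    have haw : a u = 1 / w u - 2 * I / n := by
      have hvu : v u * (u : ℂ) ^ 2 = 1 := by
        simp only [v]; push_cast; field_simp
      have hwd : w u = -(I * n / 4) * (2 * v u + I * n) * (u : ℂ) ^ 2 := by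
        simp only [w]
        linear_combination (I * n / 2) * hvu + (n : ℂ) ^ 2 * (u : ℂ) ^ 2 / 4 * I_sq
      have hI : I ≠ 0 := I_ne_zero
      rw [hwd]
      simp only [a]
      generalize v u = y at *
      field_simp
      linear_combination 2 * (2 * y + I * n) * (u : ℂ) ^ 2 * I_sq - 4 * hvu
    have hfsum : ∑' k : ℤ, f k * cexp (-Real.pi / w u * (k : ℂ) ^ 2) =
        ∑' k : ℤ, cexp (-Real.pi * a u * (k : ℂ) ^ 2) := by
      refine tsum_congr fun k ↦ ?_
      rw [← exp_add, haw]
      congr 1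
      ring
    have hgsum : ∑' k : ℤ, g k * cexp (-Real.pi / (u : ℂ) ^ 2 * (k : ℂ) ^ 2) =
        ∑' k : ℤ, cexp (-Real.pi / a u * (k : ℂ) ^ 2) := by
      refine tsum_congr fun k ↦ ?_
      rw [← exp_add, div_eq_mul_inv _ (a u), hainv]
      congr 1
      push_cast
      ring
    have husq : ((u : ℂ) ^ 2) ^ (1 / 2 : ℂ) = u := by
      rw [one_div, sq_cpow_two_inv (by simpa using hu)]
    rw [hfsum, hgsum, tsum_exp_neg_mul_int_sq hare, hw2, div_sq_cpow_half hw0 hu, husq]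
    field_simp
  have h := tendsto_nhds_unique (hL.congr' key) hR'
  have hg1 : cexp (-(Real.pi * I * n / 2)) = I ^ (-(n : ℤ)) := by
    conv_rhs => rw [← exp_pi_div_two_mul_I, ← exp_int_mul]
    congr 1
    push_cast
    ring
  have hI1 : 1 + I⁻¹ = 1 - I := by rw [inv_I]; ring
  rw [hsqrt, hsqrt'] at h
  simp only [Fin.sum_univ_two, f, g, Fin.val_zero, Fin.val_one, Int.cast_natCast] at h
  simp only [Nat.cast_zero, Nat.cast_one, one_pow, mul_one] at h
  rw [hg1] at h
  rw [hI1, ← mul_right_inj' (one_div_ne_zero hn), h]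
  field_simp
  simp

theorem sum_stdAddChar_sq (n : ℕ) [NeZero n] :
    ∑ x : ZMod n, ZMod.stdAddChar (x ^ 2) =
      (1 + I ^ (-(n : ℤ))) / (1 + I⁻¹) * Real.sqrt n := by
  rw [← sum_exp_two_pi_mul_I_sq_div]
  refine (Fintype.sum_equiv (ZMod.finEquiv n).toEquiv _ _ fun r ↦ ?_).symm
  have hr : (ZMod.finEquiv n).toEquiv r = (((r : ℕ) : ℤ) : ZMod n) := by
    obtain ⟨m, rfl⟩ := Nat.exists_eq_succ_of_ne_zero (NeZero.ne n)
    change r = _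
    rw [Int.cast_natCast]
    exact (Fin.cast_val_eq_self r).symm
  rw [hr, ← Int.cast_pow, ZMod.stdAddChar_coe]
  push_cast
  rfl

end

/-- Scaling the variable of a quadratic Gauss sum multiplies it by the quadratic character. -/
theorem sum_addChar_mul_sq {F R : Type*} [Field F] [Fintype F] [DecidableEq F] [CommRing R]
    [IsDomain R] (hF : ringChar F ≠ 2) {ψ : AddChar F R} (hψ : ψ.IsPrimitive) {k : F}
    (hk : k ≠ 0) :
    ∑ x, ψ (k * x ^ 2) = (quadraticChar F k : R) * ∑ x, ψ (x ^ 2) := by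
  have aux {c : F} (hc : c ≠ 0) :
      ∑ x, ψ (c * x ^ 2) = ∑ y, (quadraticChar F y : R) * ψ (c * y) := by
    have h0 : ∑ y, ψ (c * y) = 0 := by
      simpa [mul_comm, hc] using AddChar.sum_mulShift c hψ
    rw [← Finset.sum_fiberwise Finset.univ (fun x : F ↦ x ^ 2),
      ← add_zero (∑ y, (quadraticChar F y : R) * ψ (c * y)), ← h0, ← Finset.sum_add_distrib]
    refine Finset.sum_congr rfl fun y _ ↦ ?_
    rw [Finset.sum_congr rfl (g := fun _ ↦ ψ (c * y)) (by simp +contextual), Finset.sum_const,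
      nsmul_eq_mul]
    have h := quadraticChar_card_sqrts hF y
    have h' := congrArg (Int.cast : ℤ → R) h
    simp only [Set.toFinset_ofPred] at h'
    push_cast at h'
    rw [h']
    ring
  have h1 := aux one_ne_zero
  simp only [one_mul] at h1
  rw [aux hk, h1, Finset.mul_sum]
  refine Fintype.sum_equiv (Equiv.mulLeft₀ k hk) _ _ fun y ↦ ?_
  change _ = _ * ((quadraticChar F (k * y) : R) * ψ (k * y))
  rw [map_mul (quadraticChar F), Int.cast_mul, ← mul_assoc, ← mul_assoc, ← Int.cast_mul,
    ← sq, quadraticChar_sq_one hk, Int.cast_one, one_mul]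

/-- Gauss-sum evaluation of the trace of the conjugating matrix: for `q = e^{2πi/n}`,
`Tr(C) = (K_B/n) · (1 + i^{-n})/(1 + i^{-1}) · √n`, with `(K_B/n)` the Legendre symbol. -/
theorem trace_conjugating_matrix_gauss_evaluation
    (n : ℕ) [NeZero n] [Fact (Nat.Prime n)] (hodd : Odd n)
    (q : ℂ) (hq : q = Complex.exp (2 * Real.pi * Complex.I / n))
    (a b c d : ℤ) (hdet : a * d - b * c = 1) (hnb : ¬ (n : ℤ) ∣ b)
    (b' : ℤ) (hb' : b * b' ≡ 1 [ZMOD n])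
    (C : Matrix (ZMod n) (ZMod n) ℂ)
    (hC : ∀ i j : ZMod n, C i j
      = q ^ (-(b' * d) * ((i.val : ℤ) - a * (j.val : ℤ)) ^ 2
          - 2 * c * (j.val : ℤ) * ((i.val : ℤ) - a * (j.val : ℤ))
          - a * c * (j.val : ℤ) ^ 2))
    (K : ℤ) (hK : K = -(b' * d * (1 - a) ^ 2 + c * (2 - a))) (hnK : ¬ (n : ℤ) ∣ K) :
    Matrix.trace C
      = (legendreSym n K : ℂ)
          * ((1 + Complex.I ^ (-(n : ℤ))) / (1 + Complex.I⁻¹))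
          * Real.sqrt n := by
  have hn2 : ringChar (ZMod n) ≠ 2 := by
    rw [ZMod.ringChar_zmod_n]
    rintro rfl
    exact absurd hodd (by decide)
  have hK0 : (K : ZMod n) ≠ 0 := by rwa [Ne, ZMod.intCast_zmod_eq_zero_iff_dvd]
  have hdiag (j : ZMod n) : C j j = ZMod.stdAddChar ((K : ZMod n) * j ^ 2) := by
    have hj : (K : ZMod n) * j ^ 2 = ((K * (j.val : ℤ) ^ 2 : ℤ) : ZMod n) := by
      push_cast
      rw [ZMod.natCast_zmod_val]
    rw [hC, hj, ZMod.stdAddChar_coe, hq, ← Complex.exp_int_mul]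
    congr 1
    rw [hK]
    push_cast
    ring
  simp only [Matrix.trace, Matrix.diag_apply, hdiag]
  rw [sum_addChar_mul_sq hn2 (ZMod.isPrimitive_stdAddChar n) hK0, sum_stdAddChar_sq, mul_assoc]
  rfl
end

section
/- Let n be an odd prime and q ∈ ℂ a primitive n-th root of unity. Let a, b, c, d ∈ ℤ with ad − bc = 1 and n ∤ b, let b′ ∈ ℤ satisfy b·b′ ≡ 1 (mod n), and let C be the n×n complex matrix with entries C_{i,j} = q^{−b′d(i−aj)² − 2cj(i−aj) − acj²} for i, j ∈ {0,…,n−1}. Then C·C* = n·Iₙ, where C* is the conjugate transpose of C and Iₙ the identity matrix. -/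
/-- Summing `w ^ j` over representatives of `ZMod n` gives zero for a nontrivial `n`-th root of
unity `w`. -/
theorem ZMod.sum_pow_val_eq_zero {R : Type*} [CommRing R] [IsDomain R] {n : ℕ} [NeZero n] {w : R}
    (hw : w ^ n = 1) (hw1 : w ≠ 1) : ∑ j : ZMod n, w ^ j.val = 0 := by
  have hrange : ∑ j : ZMod n, w ^ j.val = ∑ j ∈ Finset.range n, w ^ j := by
    obtain _ | m := n
    · exact absurd rfl (NeZero.ne 0)
    · exact Fin.sum_univ_eq_sum_range (fun j => w ^ j) (m + 1)
  have hgeom := mul_geom_sum w n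
  rw [hw, sub_self] at hgeom
  rw [hrange]
  exact (mul_eq_zero.mp hgeom).resolve_left (sub_ne_zero.mpr hw1)

/-- If `ad - bc = 1` and `b'` inverts `b` modulo `n`, then `b'da - c` is a unit modulo `n`. -/
theorem isCoprime_of_det_eq_one {n a b c d b' : ℤ} (hdet : a * d - b * c = 1)
    (hb' : b * b' ≡ 1 [ZMOD n]) : IsCoprime n (b' * d * a - c) := by
  obtain ⟨t, ht⟩ := hb'.dvd
  exact ⟨t * a * d, b, by linear_combination hdet - a * d * ht⟩

/-- Complex conjugation inverts integer powers of a root of unity. -/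
theorem IsPrimitiveRoot.star_zpow {n : ℕ} [NeZero n] {q : ℂ} (hq : IsPrimitiveRoot q n) (k : ℤ) :
    star (q ^ k) = q ^ (-k) := by
  rw [star_zpow₀, zpow_neg, ← inv_zpow, Complex.inv_eq_conj (hq.norm'_eq_one (NeZero.ne n))]
  rfl


open Matrix in
/-- The conjugating matrix `C` satisfies `C·C* = n·Iₙ`. -/
theorem conjugating_matrix_mul_conjTranspose
    (n : ℕ) [NeZero n] (hp : Nat.Prime n) (hodd : Odd n)
    (q : ℂ) (hq : IsPrimitiveRoot q n)
    (a b c d : ℤ) (hdet : a * d - b * c = 1) (hnb : ¬ (n : ℤ) ∣ b)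
    (b' : ℤ) (hb' : b * b' ≡ 1 [ZMOD n])
    (C : Matrix (ZMod n) (ZMod n) ℂ)
    (hC : ∀ i j : ZMod n, C i j
      = q ^ (-(b' * d) * ((i.val : ℤ) - a * (j.val : ℤ)) ^ 2
          - 2 * c * (j.val : ℤ) * ((i.val : ℤ) - a * (j.val : ℤ))
          - a * c * (j.val : ℤ) ^ 2)) :
    C * Cᴴ = (n : ℂ) • (1 : Matrix (ZMod n) (ZMod n) ℂ) := by
  have hq0 : q ≠ 0 := hq.ne_zero (NeZero.ne n)
  ext i k
  simp only [mul_apply, conjTranspose_apply, Matrix.smul_apply, one_apply, smul_eq_mul]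
  set m : ℤ := 2 * (b' * d * a - c) * ((i.val : ℤ) - k.val) with hm
  have hterm : ∀ j : ZMod n, C i j * star (C k j)
      = q ^ (-(b' * d) * ((i.val : ℤ) ^ 2 - (k.val : ℤ) ^ 2)) * (q ^ m) ^ j.val := by
    intro j
    rw [hC, hC, hq.star_zpow, ← zpow_add₀ hq0, ← zpow_natCast, ← _root_.zpow_mul, ← zpow_add₀ hq0]
    congr 1
    rw [hm]
    ring
  simp only [hterm, ← Finset.mul_sum]
  split_ifs with hik
  · simp [hm, hik, ZMod.card]
  · rw [ZMod.sum_pow_val_eq_zero, mul_zero, mul_zero]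
    · rw [← zpow_natCast, zpow_comm, hq.zpow_eq_one, _root_.one_zpow]
    · rw [Ne, hq.zpow_eq_one_iff_dvd]
      intro hdvd
      have hn2 : IsCoprime (n : ℤ) 2 := by
        exact_mod_cast Nat.isCoprime_iff_coprime.mpr hodd.coprime_two_right
      have hsub := (hn2.mul_right (isCoprime_of_det_eq_one hdet hb')).dvd_of_dvd_mul_left hdvd
      apply hik
      have hcast := (ZMod.intCast_zmod_eq_zero_iff_dvd _ n).mpr hsub
      push_cast [ZMod.natCast_zmod_val] at hcast
      exact sub_eq_zero.mp hcast
end
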